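/- For every real number h and every real (N−1)×(N−1) matrix (H_{ij}) one has ∫_{ℝ^N₊} ( h ∂w₀/∂ξ_N(ξ) − 2 Σ_{i,j=1}^{N−1} H_{ij} ξ_N ∂²w₀/∂ξ_i∂ξ_j(ξ) ) Z₀(ξ) dξ = 𝔄₀ h − 𝔄₁ Σ_{i=1}^{N−1} H_{ii}. In particular, for i ≠ j (i,j ≤ N−1) the integral ∫_{ℝ^N₊} ξ_N ∂²w₀/∂ξ_i∂ξ_j Z₀ dξ vanishes, and for each i ≤ N−1, −2∫_{ℝ^N₊} ξ_N ∂²w₀/∂ξ_i² Z₀ dξ = −𝔄₁. -/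

import Mathlib

open MeasureTheory

noncomputable section

/-- Partial derivative in the `i`-th coordinate direction. -/
def pd {N : ℕ} (i : Fin N) (f : EuclideanSpace ℝ (Fin N) → ℝ)
    (ξ : EuclideanSpace ℝ (Fin N)) : ℝ :=
  fderiv ℝ f ξ (EuclideanSpace.single i 1)

/-- The Laplacian, as the sum of the pure second partial derivatives. -/
def lap {N : ℕ} (f : EuclideanSpace ℝ (Fin N) → ℝ)
    (ξ : EuclideanSpace ℝ (Fin N)) : ℝ :=
  ∑ i : Fin N, pd i (pd i f) ξ

/-- The standard bubble `w₀(ξ) = α_N (1+|ξ|²)^{-(N-2)/2}`,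
with `α_N = (N(N-2))^{(N-2)/4}`. -/
def w0 (N : ℕ) (ξ : EuclideanSpace ℝ (Fin N)) : ℝ :=
  ((N : ℝ) * ((N : ℝ) - 2)) ^ (((N : ℝ) - 2) / 4) *
    (1 + ‖ξ‖ ^ 2) ^ (-(((N : ℝ) - 2) / 2))

/-- The index of the last coordinate `ξ_N`. -/
def lastIdx (N : ℕ) (h : 0 < N) : Fin N := ⟨N - 1, Nat.sub_lt h Nat.one_pos⟩

/-- The open upper half space `ℝ^N₊ = {ξ : ξ_N > 0}`. -/
def upperHalf (N : ℕ) (h : 0 < N) : Set (EuclideanSpace ℝ (Fin N)) :=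
  {ξ | 0 < ξ (lastIdx N h)}

/-- The function `Z₀(ξ) = ξ·∇w₀(ξ) + ((N-2)/2) w₀(ξ)`. -/
def Zdil (N : ℕ) (ξ : EuclideanSpace ℝ (Fin N)) : ℝ :=
  (∑ i, ξ i * pd i (w0 N) ξ) + ((N : ℝ) - 2) / 2 * w0 N ξ

open Real

/-- The weight `(1+|x|²)^{-p}`. -/
def weight {N : ℕ} (p : ℝ) (x : EuclideanSpace ℝ (Fin N)) : ℝ := (1 + ‖x‖ ^ 2) ^ (-p)

section Weight

variable {N : ℕ}

lemma one_add_norm_sq_pos (x : EuclideanSpace ℝ (Fin N)) : 0 < 1 + ‖x‖ ^ 2 := by positivity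

lemma weight_pos (p : ℝ) (x : EuclideanSpace ℝ (Fin N)) : 0 < weight p x :=
  rpow_pos_of_pos (one_add_norm_sq_pos x) _

lemma weight_mul_weight (p q : ℝ) (x : EuclideanSpace ℝ (Fin N)) :
    weight p x * weight q x = weight (p + q) x := by
  unfold weight
  rw [← rpow_add (one_add_norm_sq_pos x)]
  congr 1
  ring

lemma one_add_norm_sq_mul_weight (p : ℝ) (x : EuclideanSpace ℝ (Fin N)) :
    (1 + ‖x‖ ^ 2) * weight (p + 1) x = weight p x := by
  have h := weight_mul_weight (-1) (p + 1) x
  rwa [weight, neg_neg, rpow_one, neg_add_cancel_comm_assoc] at h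

lemma continuous_weight (p : ℝ) : Continuous (weight (N := N) p) :=
  Continuous.rpow_const (by fun_prop) fun x => Or.inl (one_add_norm_sq_pos x).ne'

lemma hasFDerivAt_weight (p : ℝ) (x : EuclideanSpace ℝ (Fin N)) :
    HasFDerivAt (weight (N := N) p) ((-2 * p * weight (p + 1) x) • innerSL ℝ x) x := by
  have h := ((hasStrictFDerivAt_norm_sq x).hasFDerivAt.const_add 1).rpow_const (p := -p)
    (Or.inl (one_add_norm_sq_pos x).ne')
  refine h.congr_fderiv ?_
  ext y
  simp only [weight, _root_.smul_apply, nsmul_eq_mul, smul_eq_mul]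
  rw [show -p - 1 = -(p + 1) by ring]
  push_cast
  ring

lemma hasFDerivAt_coord (i : Fin N) (x : EuclideanSpace ℝ (Fin N)) :
    HasFDerivAt (fun y : EuclideanSpace ℝ (Fin N) => y i)
      (EuclideanSpace.proj (𝕜 := ℝ) i) x :=
  (EuclideanSpace.proj (𝕜 := ℝ) i).hasFDerivAt

lemma pd_const_mul_weight (c p : ℝ) (i : Fin N) (x : EuclideanSpace ℝ (Fin N)) :
    pd i (fun y => c * weight p y) x = -2 * p * c * (x i * weight (p + 1) x) := by
  unfold pd
  rw [((hasFDerivAt_weight p x).const_mul c).fderiv]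
  simp [EuclideanSpace.inner_single_right]
  ring

lemma pd_const_mul_coord_mul_weight (c p : ℝ) (i j : Fin N) (x : EuclideanSpace ℝ (Fin N)) :
    pd i (fun y => c * (y j * weight p y)) x =
      c * ((if i = j then 1 else 0) * weight p x - 2 * p * (x i * x j * weight (p + 1) x)) := by
  unfold pd
  rw [(((hasFDerivAt_coord j x).fun_mul (hasFDerivAt_weight p x)).const_mul c).fderiv]
  simp [EuclideanSpace.inner_single_right, eq_comm (a := i)]
  split_ifs <;> ring

lemma abs_coord_le_weight (i : Fin N) (x : EuclideanSpace ℝ (Fin N)) :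
    |x i| ≤ weight (-(1 / 2)) x := by
  have h : |x i| ≤ ‖x‖ := PiLp.norm_apply_le x i
  refine h.trans ?_
  rw [weight, neg_neg, ← sqrt_eq_rpow]
  exact le_sqrt_of_sq_le (by linarith)

lemma integrable_of_abs_le_weight {f : EuclideanSpace ℝ (Fin N) → ℝ} {p : ℝ}
    (hp : (N : ℝ) < 2 * p) (hf : Continuous f) (h : ∀ x, |f x| ≤ weight p x) :
    Integrable f := by
  refine (integrable_rpow_neg_one_add_norm_sq (E := EuclideanSpace ℝ (Fin N)) (μ := volume)
    (r := 2 * p) (by simpa using hp)).mono' hf.aestronglyMeasurable (.of_forall fun x => ?_)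
  rw [Real.norm_eq_abs, show -(2 * p) / 2 = -p by ring]
  exact h x

lemma integrable_mul_weight {f : EuclideanSpace ℝ (Fin N) → ℝ} {p q : ℝ} (hf : Continuous f)
    (h : ∀ x, |f x| ≤ weight (-q) x) (hpq : (N : ℝ) + 2 * q < 2 * p) :
    Integrable fun x => f x * weight p x := by
  refine integrable_of_abs_le_weight (p := p - q) (by linarith)
    (hf.mul (continuous_weight p)) fun x => ?_
  rw [abs_mul, abs_of_pos (weight_pos p x), show p - q = -q + p by ring, ← weight_mul_weight]
  exact mul_le_mul_of_nonneg_right (h x) (weight_pos p x).le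

lemma abs_mul_le_weight {f g : EuclideanSpace ℝ (Fin N) → ℝ} {p q : ℝ}
    (hf : ∀ x, |f x| ≤ weight (-p) x) (hg : ∀ x, |g x| ≤ weight (-q) x)
    (x : EuclideanSpace ℝ (Fin N)) : |f x * g x| ≤ weight (-(p + q)) x := by
  rw [abs_mul, neg_add, ← weight_mul_weight]
  exact mul_le_mul (hf x) (hg x) (abs_nonneg _) (weight_pos _ x).le

end Weight

section Moments

variable {N : ℕ}

lemma abs_max_coord_le_weight (L : Fin N) (x : EuclideanSpace ℝ (Fin N)) :
    |max (x L) 0| ≤ weight (-(1 / 2)) x := by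
  refine le_trans ?_ (abs_coord_le_weight L x)
  rcases le_total (x L) 0 with h | h <;> simp [h]

lemma integrable_max_coord_mul_weight (L : Fin N) {p : ℝ} (hp : (N : ℝ) + 1 < 2 * p) :
    Integrable fun x : EuclideanSpace ℝ (Fin N) => max (x L) 0 * weight p x :=
  integrable_mul_weight (by fun_prop) (abs_max_coord_le_weight L) (by linarith)

lemma integrable_max_coord_mul_coord_mul_weight (L j : Fin N) {p : ℝ}
    (hp : (N : ℝ) + 2 < 2 * p) :
    Integrable fun x : EuclideanSpace ℝ (Fin N) => max (x L) 0 * x j * weight p x :=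
  integrable_mul_weight (by fun_prop)
    (abs_mul_le_weight (abs_max_coord_le_weight L) (abs_coord_le_weight j)) (by linarith)

lemma integrable_max_coord_mul_coord_mul_coord_mul_weight (L i j : Fin N) {p : ℝ}
    (hp : (N : ℝ) + 3 < 2 * p) :
    Integrable fun x : EuclideanSpace ℝ (Fin N) => max (x L) 0 * (x i * x j) * weight p x :=
  integrable_mul_weight (by fun_prop)
    (abs_mul_le_weight (abs_max_coord_le_weight L)
      (abs_mul_le_weight (abs_coord_le_weight i) (abs_coord_le_weight j))) (by linarith)

lemma integral_lineDeriv_eq_zero {f f' : EuclideanSpace ℝ (Fin N) → ℝ}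
    {v : EuclideanSpace ℝ (Fin N)} (hf : Integrable f) (hf' : Integrable f')
    (h : ∀ x, HasLineDerivAt ℝ f (f' x) x v) : ∫ x, f' x = 0 := by
  have := integral_bilinear_hasLineDerivAt_right_eq_neg_left_of_integrable
    (μ := (volume : Measure (EuclideanSpace ℝ (Fin N)))) (f := fun _ => (1 : ℝ))
    (f' := fun _ => (0 : ℝ)) (g := f) (g' := f') (v := v) (B := ContinuousLinearMap.mul ℝ ℝ)
    (by simp) (by simpa using hf') (by simpa using hf)
    (fun x _ => hasDerivAt_const _ _) (fun x _ => h x)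
  simpa using this

lemma hasDerivAt_max_zero_mul_self (t : ℝ) :
    HasDerivAt (fun s : ℝ => max s 0 * s) (2 * max t 0) t := by
  rcases lt_trichotomy t 0 with ht | rfl | ht
  · rw [max_eq_right ht.le, mul_zero]
    refine (hasDerivAt_const t (0 : ℝ)).congr_of_eventuallyEq ?_
    filter_upwards [gt_mem_nhds ht] with s hs
    simp [hs.le]
  · rw [hasDerivAt_iff_tendsto_slope]
    have h : Filter.Tendsto (fun s : ℝ => max s 0) (nhdsWithin 0 {0}ᶜ) (nhds (2 * max 0 0)) := by
      have : Continuous fun s : ℝ => max s 0 := by fun_prop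
      simpa using (this.tendsto 0).mono_left nhdsWithin_le_nhds
    refine h.congr' ?_
    filter_upwards [self_mem_nhdsWithin] with s hs
    have hs : s ≠ 0 := hs
    simp [slope_def_field, hs]
  · rw [max_eq_left ht.le]
    have h : HasDerivAt (fun s : ℝ => s * s) (2 * t) t := by
      simpa [two_mul] using HasDerivAt.fun_mul (hasDerivAt_id' t) (hasDerivAt_id' t)
    refine h.congr_of_eventuallyEq ?_
    filter_upwards [lt_mem_nhds ht] with s hs
    simp [hs.le]

lemma hasLineDerivAt_weight (p : ℝ) (i : Fin N) (x : EuclideanSpace ℝ (Fin N)) :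
    HasLineDerivAt ℝ (weight p) (-2 * p * (x i * weight (p + 1) x)) x
      (EuclideanSpace.single i 1) := by
  have h := (hasFDerivAt_weight p x).hasLineDerivAt (EuclideanSpace.single i 1)
  simpa [EuclideanSpace.inner_single_right, mul_assoc, mul_comm (x i)] using h

lemma hasLineDerivAt_max_coord_mul_coord {L i : Fin N} (hi : i ≠ L) (j : Fin N)
    (x : EuclideanSpace ℝ (Fin N)) :
    HasLineDerivAt ℝ (fun y : EuclideanSpace ℝ (Fin N) => max (y L) 0 * y j)
      (max (x L) 0 * if i = j then 1 else 0) x (EuclideanSpace.single i 1) := by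
  have h := ((hasFDerivAt_coord j x).hasLineDerivAt
    (EuclideanSpace.single i 1)).const_mul (max (x L) 0)
  simpa [HasLineDerivAt, Pi.single_apply, hi.symm, eq_comm (a := i)] using h

lemma hasLineDerivAt_max_coord_mul_self (L : Fin N) (x : EuclideanSpace ℝ (Fin N)) :
    HasLineDerivAt ℝ (fun y : EuclideanSpace ℝ (Fin N) => max (y L) 0 * y L)
      (max (x L) 0 * 2) x (EuclideanSpace.single L 1) := by
  have h : HasDerivAt (fun s : ℝ => x L + s) 1 0 := (hasDerivAt_id 0).const_add _
  have h' := HasDerivAt.comp (0 : ℝ) (by simpa using hasDerivAt_max_zero_mul_self (x L)) h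
  simpa [HasLineDerivAt, Function.comp_def, mul_comm] using h'

lemma integral_max_coord_of_hasLineDerivAt {L i j : Fin N} {k p : ℝ}
    (hp : (N : ℝ) + 2 < 2 * p)
    (h : ∀ x, HasLineDerivAt ℝ (fun y : EuclideanSpace ℝ (Fin N) => max (y L) 0 * y j)
      (max (x L) 0 * k) x (EuclideanSpace.single i 1)) :
    2 * p * ∫ x : EuclideanSpace ℝ (Fin N), max (x L) 0 * (x i * x j) * weight (p + 1) x =
      k * ∫ x : EuclideanSpace ℝ (Fin N), max (x L) 0 * weight p x := by
  have i₁ := (integrable_max_coord_mul_weight L (p := p) (by linarith)).const_mul k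
  have i₂ := (integrable_max_coord_mul_coord_mul_coord_mul_weight L i j (p := p + 1)
    (by linarith)).const_mul (2 * p)
  have h₀ := integral_lineDeriv_eq_zero (v := EuclideanSpace.single i 1)
    (integrable_max_coord_mul_coord_mul_weight L j hp) (i₁.sub i₂) fun x => by
      have hd := HasDerivAt.fun_mul (h x) (hasLineDerivAt_weight p i x)
      refine HasDerivAt.congr_deriv hd ?_
      simp only [Pi.sub_apply, zero_smul, add_zero]
      ring
  have h₁ := integral_sub i₁ i₂
  simp only [Pi.sub_apply] at h₀
  rw [h₀, integral_const_mul, integral_const_mul] at h₁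
  linarith

variable (L : Fin N)

lemma setIntegral_coord_pos_mul (g : EuclideanSpace ℝ (Fin N) → ℝ) :
    ∫ x in {x : EuclideanSpace ℝ (Fin N) | 0 < x L}, x L * g x = ∫ x, max (x L) 0 * g x := by
  have hm : MeasurableSet {x : EuclideanSpace ℝ (Fin N) | 0 < x L} :=
    measurableSet_lt measurable_const (by fun_prop)
  rw [← integral_indicator hm]
  refine integral_congr_ae (.of_forall fun x => ?_)
  by_cases hx : 0 < x L
  · simp [Set.indicator, hx, hx.le]
  · simp [Set.indicator, hx, not_lt.mp hx]

/-- The integral of `x_L (1+|x|²)^{-p}` over `{x_L > 0}`. -/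
def moment (p : ℝ) : ℝ := ∫ x : EuclideanSpace ℝ (Fin N), max (x L) 0 * weight p x

/-- The integral of `x_L x_i x_j (1+|x|²)^{-p}` over `{x_L > 0}`. -/
def moment₂ (p : ℝ) (i j : Fin N) : ℝ :=
  ∫ x : EuclideanSpace ℝ (Fin N), max (x L) 0 * (x i * x j) * weight p x

variable {L}

lemma moment₂_tangential {p : ℝ} (hp : (N : ℝ) + 2 < 2 * p) {i : Fin N} (hi : i ≠ L)
    (j : Fin N) : 2 * p * moment₂ L (p + 1) i j = (if i = j then 1 else 0) * moment L p :=
  integral_max_coord_of_hasLineDerivAt hp (hasLineDerivAt_max_coord_mul_coord hi j)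

lemma moment₂_normal {p : ℝ} (hp : (N : ℝ) + 2 < 2 * p) :
    2 * p * moment₂ L (p + 1) L L = 2 * moment L p :=
  integral_max_coord_of_hasLineDerivAt hp (hasLineDerivAt_max_coord_mul_self L)

lemma sum_moment₂ {p : ℝ} (hp : (N : ℝ) + 2 < 2 * p) :
    ∑ i, moment₂ L (p + 1) i i = moment L p - moment L (p + 1) := by
  unfold moment moment₂
  rw [← integral_finsetSum _ fun i _ =>
      integrable_max_coord_mul_coord_mul_coord_mul_weight L i i (by linarith),
    ← integral_sub (integrable_max_coord_mul_weight L (by linarith))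
      (integrable_max_coord_mul_weight L (by linarith))]
  refine integral_congr_ae (.of_forall fun x => ?_)
  simp only
  rw [← Finset.sum_mul, ← Finset.mul_sum, ← one_add_norm_sq_mul_weight p x,
    EuclideanSpace.real_norm_sq_eq]
  simp only [sq]
  ring

lemma moment_succ {p : ℝ} (hp : (N : ℝ) + 2 < 2 * p) :
    2 * p * moment L (p + 1) = (2 * p - N - 1) * moment L p := by
  have h : ∀ i, 2 * p * moment₂ L (p + 1) i i = (1 + if i = L then 1 else 0) * moment L p := by
    intro i
    by_cases hi : i = L
    · subst hi
      rw [moment₂_normal hp]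
      norm_num
    · simp [moment₂_tangential hp hi, hi]
  have hs := congrArg (2 * p * ·) (sum_moment₂ (L := L) hp)
  simp only [Finset.mul_sum, h, ← Finset.sum_mul, Finset.sum_add_distrib] at hs
  simp at hs
  linarith

end Moments

section Bubble

variable {N : ℕ}

/-- The normalizing constant of the bubble. -/
def bubbleConst (N : ℕ) : ℝ := ((N : ℝ) * ((N : ℝ) - 2)) ^ (((N : ℝ) - 2) / 4)

lemma w0_eq : w0 N = fun x => bubbleConst N * weight (((N : ℝ) - 2) / 2) x := rfl

lemma pd_w0 (i : Fin N) (x : EuclideanSpace ℝ (Fin N)) :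
    pd i (w0 N) x = -((N : ℝ) - 2) * bubbleConst N * (x i * weight ((N : ℝ) / 2) x) := by
  rw [w0_eq, pd_const_mul_weight, show ((N : ℝ) - 2) / 2 + 1 = N / 2 by ring]
  ring

lemma pd_pd_w0 (i j : Fin N) (x : EuclideanSpace ℝ (Fin N)) :
    pd i (pd j (w0 N)) x = -((N : ℝ) - 2) * bubbleConst N *
      ((if i = j then 1 else 0) * weight ((N : ℝ) / 2) x
        - N * (x i * x j * weight ((N : ℝ) / 2 + 1) x)) := by
  rw [show pd j (w0 N) = _ from funext (pd_w0 j), pd_const_mul_coord_mul_weight]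
  ring

lemma Zdil_eq (x : EuclideanSpace ℝ (Fin N)) :
    Zdil N x = ((N : ℝ) - 2) / 2 * bubbleConst N *
      (2 * weight ((N : ℝ) / 2) x - weight (((N : ℝ) - 2) / 2) x) := by
  have h := one_add_norm_sq_mul_weight (((N : ℝ) - 2) / 2) x
  rw [show ((N : ℝ) - 2) / 2 + 1 = N / 2 by ring] at h
  have hs : ∑ i, x i * pd i (w0 N) x =
      -((N : ℝ) - 2) * bubbleConst N * (‖x‖ ^ 2 * weight ((N : ℝ) / 2) x) := by
    rw [EuclideanSpace.real_norm_sq_eq, Finset.sum_mul, Finset.mul_sum]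
    refine Finset.sum_congr rfl fun i _ => ?_
    rw [pd_w0]
    ring
  rw [Zdil, hs, w0_eq]
  linear_combination (-((N : ℝ) - 2) * bubbleConst N) * h

lemma weight_half_mul_half (x : EuclideanSpace ℝ (Fin N)) :
    weight ((N : ℝ) / 2) x * weight ((N : ℝ) / 2) x = weight (N : ℝ) x := by
  rw [weight_mul_weight, add_halves]

lemma weight_half_mul_half_sub_one (x : EuclideanSpace ℝ (Fin N)) :
    weight ((N : ℝ) / 2) x * weight (((N : ℝ) - 2) / 2) x = weight ((N : ℝ) - 1) x := by
  rw [weight_mul_weight]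
  congr 1
  ring

lemma pd_w0_mul_Zdil (i : Fin N) (x : EuclideanSpace ℝ (Fin N)) :
    pd i (w0 N) x * Zdil N x = x i * (((N : ℝ) - 2) ^ 2 / 2 * bubbleConst N ^ 2 *
      (weight ((N : ℝ) - 1) x - 2 * weight (N : ℝ) x)) := by
  rw [pd_w0, Zdil_eq, ← weight_half_mul_half, ← weight_half_mul_half_sub_one]
  ring

lemma pd_pd_w0_mul_Zdil (i j : Fin N) (x : EuclideanSpace ℝ (Fin N)) :
    pd i (pd j (w0 N)) x * Zdil N x = ((N : ℝ) - 2) ^ 2 / 2 * bubbleConst N ^ 2 *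
      ((if i = j then 1 else 0) * (weight ((N : ℝ) - 1) x - 2 * weight (N : ℝ) x)
        + N * (2 * (x i * x j * weight ((N : ℝ) + 1) x) - x i * x j * weight (N : ℝ) x)) := by
  have h₁ : weight ((N : ℝ) / 2 + 1) x * weight ((N : ℝ) / 2) x = weight ((N : ℝ) + 1) x := by
    rw [weight_mul_weight]
    congr 1
    ring
  have h₂ : weight ((N : ℝ) / 2 + 1) x * weight (((N : ℝ) - 2) / 2) x = weight (N : ℝ) x := by
    rw [weight_mul_weight]
    congr 1
    ring
  have h₃ := weight_half_mul_half x
  have h₄ := weight_half_mul_half_sub_one x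
  rw [pd_pd_w0, Zdil_eq]
  linear_combination (((N : ℝ) - 2) ^ 2 / 2 * bubbleConst N ^ 2) *
    ((if i = j then (1 : ℝ) else 0) * (h₄ - 2 * h₃) + N * (x i * x j) * (2 * h₁ - h₂))

lemma sum_pd_w0_sq (x : EuclideanSpace ℝ (Fin N)) :
    ∑ i, pd i (w0 N) x ^ 2 = ((N : ℝ) - 2) ^ 2 * bubbleConst N ^ 2 *
      (weight ((N : ℝ) - 1) x - weight (N : ℝ) x) := by
  have h := one_add_norm_sq_mul_weight ((N : ℝ) - 1) x
  rw [sub_add_cancel] at h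
  rw [← h, ← weight_half_mul_half, add_mul, one_mul, add_sub_cancel_left,
    EuclideanSpace.real_norm_sq_eq, Finset.sum_mul, Finset.mul_sum]
  refine Finset.sum_congr rfl fun i _ => ?_
  rw [pd_w0]
  ring

lemma w0_rpow_critical (hN : 2 < N) (x : EuclideanSpace ℝ (Fin N)) :
    w0 N x ^ (2 * (N : ℝ) / ((N : ℝ) - 2)) =
      N * ((N : ℝ) - 2) * bubbleConst N ^ 2 * weight (N : ℝ) x := by
  have hN' : (2 : ℝ) < N := by exact_mod_cast hN
  have h₀ : (0 : ℝ) < N * ((N : ℝ) - 2) := mul_pos (by linarith) (by linarith)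
  have h₂ : (N : ℝ) - 2 ≠ 0 := by linarith
  have hc : bubbleConst N ^ (2 * (N : ℝ) / ((N : ℝ) - 2)) =
      N * ((N : ℝ) - 2) * bubbleConst N ^ 2 := by
    rw [← rpow_natCast, bubbleConst, ← rpow_mul h₀.le, ← rpow_mul h₀.le, ← rpow_one_add' h₀.le]
    · congr 1
      push_cast
      field_simp
      ring
    · push_cast
      linarith
  have hb : 0 ≤ bubbleConst N := rpow_nonneg h₀.le _
  rw [w0_eq, mul_rpow hb (weight_pos _ x).le, hc, weight, weight,
    ← rpow_mul (one_add_norm_sq_pos x).le]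
  congr 2
  field_simp

lemma integrableOn_coord_pos_mul (L : Fin N) {g : EuclideanSpace ℝ (Fin N) → ℝ}
    (hg : Integrable fun x => max (x L) 0 * g x) :
    IntegrableOn (fun x => x L * g x) {x : EuclideanSpace ℝ (Fin N) | 0 < x L} := by
  refine hg.integrableOn.congr_fun (fun x hx => ?_)
    (measurableSet_lt measurable_const (by fun_prop))
  have hx : 0 < x L := hx
  simp [hx.le]

variable (L : Fin N)

lemma hasIntegral_moment_comb {p q : ℝ} (hp : (N : ℝ) + 1 < 2 * p) (hq : (N : ℝ) + 1 < 2 * q)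
    (a b : ℝ) :
    (Integrable fun x : EuclideanSpace ℝ (Fin N) =>
      max (x L) 0 * (a * weight p x + b * weight q x)) ∧
    ∫ x : EuclideanSpace ℝ (Fin N), max (x L) 0 * (a * weight p x + b * weight q x) =
      a * moment L p + b * moment L q := by
  have i₁ := (integrable_max_coord_mul_weight L hp).const_mul a
  have i₂ := (integrable_max_coord_mul_weight L hq).const_mul b
  have he : (fun x : EuclideanSpace ℝ (Fin N) =>
      max (x L) 0 * (a * weight p x + b * weight q x)) = fun x =>
      a * (max (x L) 0 * weight p x) + b * (max (x L) 0 * weight q x) := by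
    ext x
    ring
  rw [he, integral_add i₁ i₂, integral_const_mul, integral_const_mul]
  exact ⟨i₁.add i₂, rfl⟩

lemma hasIntegral_moment₂_comb {p q : ℝ} (hp : (N : ℝ) + 3 < 2 * p) (hq : (N : ℝ) + 3 < 2 * q)
    (a b : ℝ) (i j : Fin N) :
    (Integrable fun x : EuclideanSpace ℝ (Fin N) =>
      max (x L) 0 * (a * (x i * x j * weight p x) + b * (x i * x j * weight q x))) ∧
    ∫ x : EuclideanSpace ℝ (Fin N),
        max (x L) 0 * (a * (x i * x j * weight p x) + b * (x i * x j * weight q x)) =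
      a * moment₂ L p i j + b * moment₂ L q i j := by
  have i₁ := (integrable_max_coord_mul_coord_mul_coord_mul_weight L i j hp).const_mul a
  have i₂ := (integrable_max_coord_mul_coord_mul_coord_mul_weight L i j hq).const_mul b
  have he : (fun x : EuclideanSpace ℝ (Fin N) =>
      max (x L) 0 * (a * (x i * x j * weight p x) + b * (x i * x j * weight q x))) = fun x =>
      a * (max (x L) 0 * (x i * x j) * weight p x)
        + b * (max (x L) 0 * (x i * x j) * weight q x) := by
    ext x
    ring
  rw [he, integral_add i₁ i₂, integral_const_mul, integral_const_mul]
  exact ⟨i₁.add i₂, rfl⟩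

lemma hasIntegral_pd_w0_mul_Zdil (hN : 5 ≤ N) :
    IntegrableOn (fun x => pd L (w0 N) x * Zdil N x) {x | 0 < x L} ∧
    ∫ x in {x | 0 < x L}, pd L (w0 N) x * Zdil N x =
      ((N : ℝ) - 2) ^ 2 / 2 * bubbleConst N ^ 2 *
        (moment L ((N : ℝ) - 1) - 2 * moment L (N : ℝ)) := by
  have hN' : (5 : ℝ) ≤ N := by exact_mod_cast hN
  set K := ((N : ℝ) - 2) ^ 2 / 2 * bubbleConst N ^ 2
  obtain ⟨hi, hv⟩ := hasIntegral_moment_comb L (p := (N : ℝ) - 1) (q := N) (by linarith)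
    (by linarith) K (-2 * K)
  have he : (fun x => pd L (w0 N) x * Zdil N x) = fun x =>
      x L * (K * weight ((N : ℝ) - 1) x + -2 * K * weight (N : ℝ) x) := by
    ext x
    rw [pd_w0_mul_Zdil]
    ring
  rw [he]
  refine ⟨integrableOn_coord_pos_mul L hi, ?_⟩
  rw [setIntegral_coord_pos_mul, hv]
  ring

lemma integral_sum_pd_w0_sq (hN : 5 ≤ N) :
    ∫ x in {x : EuclideanSpace ℝ (Fin N) | 0 < x L}, x L * ∑ i, pd i (w0 N) x ^ 2 =
      ((N : ℝ) - 2) ^ 2 * bubbleConst N ^ 2 * (moment L ((N : ℝ) - 1) - moment L (N : ℝ)) := by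
  have hN' : (5 : ℝ) ≤ N := by exact_mod_cast hN
  set K := ((N : ℝ) - 2) ^ 2 * bubbleConst N ^ 2
  have hv := (hasIntegral_moment_comb L (p := (N : ℝ) - 1) (q := N) (by linarith)
    (by linarith) K (-K)).2
  simp only [sum_pd_w0_sq]
  rw [setIntegral_coord_pos_mul]
  simp only [neg_mul, ← sub_eq_add_neg, ← mul_sub] at hv
  exact hv

lemma integral_w0_rpow_critical (hN : 2 < N) :
    ∫ x in {x : EuclideanSpace ℝ (Fin N) | 0 < x L},
        x L * w0 N x ^ (2 * (N : ℝ) / ((N : ℝ) - 2)) =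
      N * ((N : ℝ) - 2) * bubbleConst N ^ 2 * moment L (N : ℝ) := by
  simp only [w0_rpow_critical hN]
  rw [setIntegral_coord_pos_mul, moment, ← integral_const_mul]
  simp only [mul_left_comm]

lemma integral_pd_w0_sq (i : Fin N) :
    ∫ x in {x : EuclideanSpace ℝ (Fin N) | 0 < x L}, x L * pd i (w0 N) x ^ 2 =
      ((N : ℝ) - 2) ^ 2 * bubbleConst N ^ 2 * moment₂ L (N : ℝ) i i := by
  rw [setIntegral_coord_pos_mul, moment₂, ← integral_const_mul]
  refine integral_congr_ae (.of_forall fun x => ?_)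
  simp only [pd_w0, ← weight_half_mul_half]
  ring

variable {L}

lemma moment₂_card (hN : 5 ≤ N) {i : Fin N} (hi : i ≠ L) (j : Fin N) :
    2 * ((N : ℝ) - 1) * moment₂ L (N : ℝ) i j =
      (if i = j then 1 else 0) * moment L ((N : ℝ) - 1) := by
  have hN' : (5 : ℝ) ≤ N := by exact_mod_cast hN
  simpa using moment₂_tangential (p := (N : ℝ) - 1) (by linarith) hi j

lemma hasIntegral_pd_pd_w0_mul_Zdil (hN : 5 ≤ N) {i : Fin N} (hi : i ≠ L) (j : Fin N) :
    IntegrableOn (fun x => x L * pd i (pd j (w0 N)) x * Zdil N x) {x | 0 < x L} ∧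
    ∫ x in {x | 0 < x L}, x L * pd i (pd j (w0 N)) x * Zdil N x =
      ((N : ℝ) - 2) ^ 2 / 2 * bubbleConst N ^ 2 * moment₂ L (N : ℝ) i j := by
  have hN' : (5 : ℝ) ≤ N := by exact_mod_cast hN
  set K := ((N : ℝ) - 2) ^ 2 / 2 * bubbleConst N ^ 2
  set δ : ℝ := if i = j then 1 else 0 with hδ
  obtain ⟨hi₁, hv₁⟩ := hasIntegral_moment_comb L (p := (N : ℝ) - 1) (q := N) (by linarith)
    (by linarith) (K * δ) (-2 * K * δ)
  obtain ⟨hi₂, hv₂⟩ := hasIntegral_moment₂_comb L (p := (N : ℝ) + 1) (q := N) (by linarith)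
    (by linarith) (2 * K * N) (-K * N) i j
  have he : (fun x => x L * pd i (pd j (w0 N)) x * Zdil N x) = fun x =>
      x L * ((K * δ * weight ((N : ℝ) - 1) x + -2 * K * δ * weight (N : ℝ) x) +
        (2 * K * N * (x i * x j * weight ((N : ℝ) + 1) x)
          + -K * N * (x i * x j * weight (N : ℝ) x))) := by
    ext x
    rw [mul_assoc, pd_pd_w0_mul_Zdil]
    ring
  have hsum := hi₁.add hi₂
  have hval := integral_add hi₁ hi₂
  simp only [← mul_add] at hval
  rw [he]
  refine ⟨integrableOn_coord_pos_mul L (hsum.congr (.of_forall fun x => ?_)), ?_⟩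
  · simp only [Pi.add_apply, ← mul_add]
  rw [setIntegral_coord_pos_mul, hval, hv₁, hv₂]
  have h₁ := moment₂_card hN hi j
  have h₂ := moment₂_tangential (p := (N : ℝ)) (by linarith) hi j
  have h₃ := moment_succ (L := L) (p := (N : ℝ) - 1) (by linarith)
  rw [sub_add_cancel] at h₃
  rw [← hδ] at h₁ h₂
  have hne : 2 * ((N : ℝ) - 1) ≠ 0 := by linarith
  refine mul_left_cancel₀ hne ?_
  linear_combination (2 * ((N : ℝ) - 1) * K) * h₂ - (K * δ) * h₃ - (K * (N + 1)) * h₁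

end Bubble

/-- for every `h : ℝ` and every real `(N-1)×(N-1)` matrix `H`,
`∫_{ℝ^N₊} (h ∂_N w₀ - 2 Σ_{ij} H_{ij} ξ_N ∂²_{ij} w₀) Z₀ = 𝔄₀ h - 𝔄₁ Σ_i H_{ii}`;
in particular the mixed integrals vanish and the diagonal ones equal `-𝔄₁/(-2)`. -/
theorem stmt9 (N : ℕ) (hN : 5 ≤ N) (h : ℝ)
    (H : Matrix (Fin (N - 1)) (Fin (N - 1)) ℝ) :
    (∫ ξ in upperHalf N (by omega),
        (h * pd (lastIdx N (by omega)) (w0 N) ξ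
          - 2 * ∑ i : Fin (N - 1), ∑ j : Fin (N - 1),
              H i j * (ξ (lastIdx N (by omega)) *
                pd (Fin.castLE (by omega) i) (pd (Fin.castLE (by omega) j) (w0 N)) ξ))
          * Zdil N ξ)
      = ((1 : ℝ) / 2 * (∫ ξ in upperHalf N (by omega),
            ξ (lastIdx N (by omega)) * ∑ i, (pd i (w0 N) ξ) ^ 2)
          - ((N : ℝ) - 2) / (2 * (N : ℝ)) * (∫ ξ in upperHalf N (by omega),
              ξ (lastIdx N (by omega)) * w0 N ξ ^ (2 * (N : ℝ) / ((N : ℝ) - 2)))) * h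
        - (∫ ξ in upperHalf N (by omega),
            ξ (lastIdx N (by omega)) * (pd (⟨0, by omega⟩ : Fin N) (w0 N) ξ) ^ 2)
          * ∑ i, H i i ∧
    (∀ i j : Fin (N - 1), i ≠ j →
      (∫ ξ in upperHalf N (by omega),
          ξ (lastIdx N (by omega)) *
            pd (Fin.castLE (by omega) i) (pd (Fin.castLE (by omega) j) (w0 N)) ξ *
            Zdil N ξ) = 0) ∧
    (∀ i : Fin (N - 1),
      -2 * (∫ ξ in upperHalf N (by omega),
          ξ (lastIdx N (by omega)) *
            pd (Fin.castLE (by omega) i) (pd (Fin.castLE (by omega) i) (w0 N)) ξ *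
            Zdil N ξ)
        = -(∫ ξ in upperHalf N (by omega),
            ξ (lastIdx N (by omega)) * (pd (⟨0, by omega⟩ : Fin N) (w0 N) ξ) ^ 2)) := by
  have hN' : (5 : ℝ) ≤ N := by exact_mod_cast hN
  have hcast : ∀ i : Fin (N - 1),
      (Fin.castLE (by omega) i : Fin N) ≠ lastIdx N (by omega) := fun i hi => by
    have h₁ := congrArg Fin.val hi
    have h₂ := i.isLt
    simp only [Fin.val_castLE, lastIdx] at h₁
    omega
  have hzero : (⟨0, by omega⟩ : Fin N) ≠ lastIdx N (by omega) := by
    simp only [lastIdx, ne_eq, Fin.mk.injEq]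
    omega
  set L := lastIdx N (by omega)
  have hne : 2 * ((N : ℝ) - 1) ≠ 0 := by linarith
  have hmix : ∀ i j : Fin (N - 1), i ≠ j →
      moment₂ L (N : ℝ) (Fin.castLE (by omega) i) (Fin.castLE (by omega) j) = 0 := by
    intro i j hij
    have h₁ := moment₂_card hN (hcast i) (Fin.castLE (by omega) j)
    rw [if_neg fun h => hij (Fin.castLE_injective _ h), zero_mul] at h₁
    exact (mul_eq_zero.mp h₁).resolve_left hne
  have hdiag : ∀ i : Fin (N - 1),
      moment₂ L (N : ℝ) (Fin.castLE (by omega) i) (Fin.castLE (by omega) i) =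
        moment₂ L (N : ℝ) ⟨0, by omega⟩ ⟨0, by omega⟩ := by
    intro i
    have h₁ := moment₂_card hN (hcast i) (Fin.castLE (by omega) i)
    have h₂ := moment₂_card hN hzero ⟨0, by omega⟩
    rw [if_pos rfl] at h₁ h₂
    exact mul_left_cancel₀ hne (h₁.trans h₂.symm)
  have hU : upperHalf N (by omega) = {x : EuclideanSpace ℝ (Fin N) | 0 < x L} := rfl
  rw [hU]
  refine ⟨?_, fun i j hij => ?_, fun i => ?_⟩
  · obtain ⟨hi, hv⟩ := hasIntegral_pd_w0_mul_Zdil L hN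
    have hij := fun i j : Fin (N - 1) =>
      hasIntegral_pd_pd_w0_mul_Zdil hN (hcast i) (Fin.castLE (by omega) j)
    have he : ∀ x : EuclideanSpace ℝ (Fin N),
        (h * pd L (w0 N) x - 2 * ∑ i : Fin (N - 1), ∑ j : Fin (N - 1), H i j *
          (x L * pd (Fin.castLE (by omega) i) (pd (Fin.castLE (by omega) j) (w0 N)) x))
            * Zdil N x =
        h * (pd L (w0 N) x * Zdil N x) - 2 * ∑ i : Fin (N - 1), ∑ j : Fin (N - 1), H i j *
          (x L * pd (Fin.castLE (by omega) i) (pd (Fin.castLE (by omega) j) (w0 N)) x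
            * Zdil N x) := by
      intro x
      simp only [← mul_assoc (H _ _), ← Finset.sum_mul]
      ring
    simp only [he]
    have hin := fun i : Fin (N - 1) =>
      integrable_finsetSum Finset.univ fun j _ => (hij i j).1.const_mul (H i j)
    rw [integral_sub (hi.const_mul h)
        ((integrable_finsetSum Finset.univ fun i _ => hin i).const_mul 2),
      integral_const_mul, integral_const_mul, integral_finsetSum _ fun i _ => hin i, hv,
      integral_sum_pd_w0_sq L hN, integral_w0_rpow_critical L (by omega), integral_pd_w0_sq]
    have hs : ∀ i : Fin (N - 1), ∫ x in {x : EuclideanSpace ℝ (Fin N) | 0 < x L},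
        ∑ j : Fin (N - 1), H i j *
          (x L * pd (Fin.castLE (by omega) i) (pd (Fin.castLE (by omega) j) (w0 N)) x
            * Zdil N x) =
        ((N : ℝ) - 2) ^ 2 / 2 * bubbleConst N ^ 2 *
          moment₂ L (N : ℝ) ⟨0, by omega⟩ ⟨0, by omega⟩ * H i i := by
      intro i
      rw [integral_finsetSum _ fun j _ => (hij i j).1.const_mul (H i j),
        Finset.sum_eq_single i]
      · rw [integral_const_mul, (hij i i).2, hdiag i]
        ring
      · intro j _ hji
        rw [integral_const_mul, (hij i j).2, hmix i j hji.symm]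
        ring
      · simp
    simp only [hs, ← Finset.mul_sum]
    field_simp
    ring
  · rw [(hasIntegral_pd_pd_w0_mul_Zdil hN (hcast i) _).2, hmix i j hij, mul_zero]
  · rw [(hasIntegral_pd_pd_w0_mul_Zdil hN (hcast i) _).2, integral_pd_w0_sq, hdiag i]
    ring
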